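/- arXiv:1505.07123 — 2 statements merged into one kernel-verified Lean document; each statement's English description precedes it below -/
import Mathlib

section
/- Let (E, 𝓛, ℬ) be a weakly left resolving labelled space with associated inverse semigroup S, and let ξ^α be a filter in E(S) of infinite type (α ∈ 𝓛^∞(E)) with associated complete family {ξ_n}_{n≥0}. Then ξ^α is an ultrafilter in E(S) if and only if {ξ_n}_{n≥0} is maximal among all complete families for α, i.e. whenever {F_n}_{n≥0} is a complete family for α with ξ_n ⊆ F_n for all n ≥ 0, then ξ_n = F_n for all n ≥ 0. -/
universe u v w

attribute [local instance] Classical.propDecidable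

/-- Elements of the semigroups `T` and `S` associated with a labelled space:
`none` plays the role of the zero element, and `some (α, A, β)` is a triple. -/
abbrev STrip (V : Type u) (L : Type w) := List L × Set V × List L

/-- A labelled graph: a directed graph `(V, Ed, rng, src)` together with a labelling
map `lbl` on edges, over the alphabet `L`. -/
structure LabelledGraph (V : Type u) (Ed : Type v) (L : Type w) where
  src : Ed → V
  rng : Ed → V
  lbl : Ed → L

namespace LabelledGraph

variable {V : Type u} {Ed : Type v} {L : Type w} (G : LabelledGraph V Ed L)

/-- A (finite) path: a list of edges with matching ranges and sources. -/
def IsPath (p : List Ed) : Prop := p.Chain' (fun e f => G.rng e = G.src f)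

/-- `α ∈ 𝓛*(E)`: the labels of finite paths, together with the empty word `[]`. -/
def IsWord (α : List L) : Prop := ∃ p : List Ed, G.IsPath p ∧ p.map G.lbl = α

/-- The relative range `r(A, α)`, with `r(A, ω) = A` for the empty word. -/
def relRange (A : Set V) : List L → Set V
  | [] => A
  | a :: w =>
      {v | ∃ (p : List Ed) (h : p ≠ []), G.IsPath p ∧ p.map G.lbl = a :: w ∧
        G.src (p.head h) ∈ A ∧ G.rng (p.getLast h) = v}

/-- `r(α) = r(E⁰, α)`. -/
def range (α : List L) : Set V := G.relRange Set.univ α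

/-- `ℬ_α = ℬ ∩ 𝒫(r(α))`. -/
def rFam (ℬ : Set (Set V)) (α : List L) : Set (Set V) := {A ∈ ℬ | A ⊆ G.range α}

/-- `ℬ` is accommodating for the labelled graph `G`: closed under relative ranges,
finite intersections and unions, and contains `r(α)` for every nonempty word `α`. -/
def Accommodating (ℬ : Set (Set V)) : Prop :=
  (∀ A ∈ ℬ, ∀ α : List L, G.IsWord α → G.relRange A α ∈ ℬ) ∧
  (∀ A ∈ ℬ, ∀ B ∈ ℬ, A ∩ B ∈ ℬ) ∧
  (∀ A ∈ ℬ, ∀ B ∈ ℬ, A ∪ B ∈ ℬ) ∧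
  (∀ α : List L, α ≠ [] → G.IsWord α → G.range α ∈ ℬ)

/-- The labelled space `(G, ℬ)` is weakly left resolving. -/
def WeaklyLeftResolving (ℬ : Set (Set V)) : Prop :=
  ∀ A ∈ ℬ, ∀ B ∈ ℬ, ∀ α : List L, α ≠ [] →
    G.relRange (A ∩ B) α = G.relRange A α ∩ G.relRange B α

/-- `ℬ` is closed under relative complements. -/
def ClosedUnderRelComp (ℬ : Set (Set V)) : Prop :=
  ∀ A ∈ ℬ, ∀ B ∈ ℬ, A \ B ∈ ℬ

/-- Membership in the semigroup `T`: either the zero `none`, or a triple `(α, A, β)`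
with `α, β ∈ 𝓛*(E)` and `A ∈ ℬ_α ∩ ℬ_β`. -/
def ValidT (ℬ : Set (Set V)) (t : Option (STrip V L)) : Prop :=
  ∀ x ∈ t, G.IsWord x.1 ∧ G.IsWord x.2.2 ∧ x.2.1 ∈ G.rFam ℬ x.1 ∧ x.2.1 ∈ G.rFam ℬ x.2.2

/-- Membership in the inverse semigroup `S`: as in `T`, but triples with empty middle
set are identified with the zero, so nonzero elements have nonempty middle set. -/
def ValidS (ℬ : Set (Set V)) (t : Option (STrip V L)) : Prop :=
  G.ValidT ℬ t ∧ ∀ x ∈ t, x.2.1 ≠ (∅ : Set V)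

/-- The product on `T`. -/
noncomputable def mulT : Option (STrip V L) → Option (STrip V L) → Option (STrip V L)
  | some (α, A, β), some (γ, B, δ) =>
      if β <+: γ then
        some (α ++ γ.drop β.length, G.relRange A (γ.drop β.length) ∩ B, δ)
      else if γ <+: β then
        some (α, A ∩ G.relRange B (β.drop γ.length), δ ++ β.drop γ.length)
      else none
  | _, _ => none

/-- The product on `S`: the product of `T`, with triples having empty middle set
collapsed to the zero element. -/
noncomputable def mulS (s t : Option (STrip V L)) : Option (STrip V L) :=
  match G.mulT s t with
  | none => none
  | some (α, A, β) => if A = (∅ : Set V) then none else some (α, A, β)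

/-- A nonzero idempotent `(α, A, α)` of `S`, represented as the pair `(α, A)`. -/
def ValidE (ℬ : Set (Set V)) (p : List L × Set V) : Prop :=
  G.IsWord p.1 ∧ p.2 ∈ G.rFam ℬ p.1 ∧ p.2 ≠ (∅ : Set V)

/-- The natural order on nonzero idempotents of `S`:
`(α, A, α) ≤ (β, B, β)` iff `α = βγ` and `A ⊆ r(B, γ)`. -/
def esLe (p q : List L × Set V) : Prop :=
  ∃ γ : List L, p.1 = q.1 ++ γ ∧ p.2 ⊆ G.relRange q.2 γ

/-- `p ∧ q ≠ 0` for nonzero idempotents `p`, `q` of `S`. -/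
def meetNeZero (p q : List L × Set V) : Prop :=
  (∃ γ : List L, q.1 = p.1 ++ γ ∧ (G.relRange p.2 γ ∩ q.2).Nonempty) ∨
  (∃ γ : List L, p.1 = q.1 ++ γ ∧ (p.2 ∩ G.relRange q.2 γ).Nonempty)

/-- A filter in the semilattice `E(S)`, identified with its set of (nonzero) elements:
nonempty, not containing `0`, upward closed and downward directed. -/
def IsFilterES (ℬ : Set (Set V)) (ξ : Set (List L × Set V)) : Prop :=
  ξ.Nonempty ∧ (∀ p ∈ ξ, G.ValidE ℬ p) ∧
  (∀ p ∈ ξ, ∀ q, G.ValidE ℬ q → G.esLe p q → q ∈ ξ) ∧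
  (∀ p ∈ ξ, ∀ q ∈ ξ, ∃ z ∈ ξ, G.esLe z p ∧ G.esLe z q)

/-- An ultrafilter in `E(S)`: a filter not properly contained in any filter. -/
def IsUltraES (ℬ : Set (Set V)) (ξ : Set (List L × Set V)) : Prop :=
  G.IsFilterES ℬ ξ ∧ ∀ η, G.IsFilterES ℬ η → ξ ⊆ η → ξ = η

/-- `Z` is a cover for `x` in `E(S)`: `Z ⊆ ↓x` and every nonzero `y ≤ x` meets some
element of `Z` nontrivially. -/
def IsCover (ℬ : Set (Set V)) (Z : Set (List L × Set V)) (x : List L × Set V) : Prop :=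
  (∀ z ∈ Z, G.ValidE ℬ z ∧ G.esLe z x) ∧
  ∀ y, G.ValidE ℬ y → G.esLe y x → ∃ z ∈ Z, G.meetNeZero z y

/-- A tight filter in `E(S)`: a filter meeting every finite cover of each of its
elements. -/
def IsTight (ℬ : Set (Set V)) (ξ : Set (List L × Set V)) : Prop :=
  G.IsFilterES ℬ ξ ∧
  ∀ x ∈ ξ, ∀ Z : Set (List L × Set V), Z.Finite → G.IsCover ℬ Z x → (Z ∩ ξ).Nonempty

/-- A filter in a family `𝒞` of subsets of `V` (e.g. `ℬ_α`), ordered by inclusion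
with least element `∅`. -/
def IsFilterIn (𝒞 F : Set (Set V)) : Prop :=
  F.Nonempty ∧ F ⊆ 𝒞 ∧ (∅ : Set V) ∉ F ∧
  (∀ A ∈ F, ∀ B ∈ 𝒞, A ⊆ B → B ∈ F) ∧
  (∀ A ∈ F, ∀ B ∈ F, ∃ C ∈ F, C ⊆ A ∧ C ⊆ B)

/-- An ultrafilter in a family `𝒞` of subsets of `V`. -/
def IsUltraIn (𝒞 F : Set (Set V)) : Prop :=
  IsFilterIn 𝒞 F ∧ ∀ F', IsFilterIn 𝒞 F' → F ⊆ F' → F = F'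

/-- `α ∈ 𝓛^∞(E)`: labels of infinite paths. -/
def IsInfWord (α : ℕ → L) : Prop :=
  ∃ p : ℕ → Ed, (∀ n, G.rng (p n) = G.src (p (n + 1))) ∧ ∀ n, G.lbl (p n) = α n

end LabelledGraph

/-- `α_{n+1, m}` (in the 1-indexed notation of the paper): the finite subword of the
infinite word `α` consisting of its letters at (0-indexed) positions `n, …, m-1`. -/
def LabelledGraph.seg {L : Type w} (α : ℕ → L) (n m : ℕ) : List L :=
  (List.range (m - n)).map fun i => α (n + i)

/-- `α_{1, n}`: the first `n` letters of the infinite word `α`. -/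
def LabelledGraph.prefixN {L : Type w} (α : ℕ → L) (n : ℕ) : List L :=
  LabelledGraph.seg α 0 n

namespace LabelledGraph

variable {V : Type u} {Ed : Type v} {L : Type w} (G : LabelledGraph V Ed L)

/-- A family `{F n}` as in the paper: `F n` is a filter in `ℬ_{α_{1,n}}` for `n > 0`,
and `F 0` is a filter in `ℬ` or empty. -/
def IsFam (ℬ : Set (Set V)) (α : ℕ → L) (F : ℕ → Set (Set V)) : Prop :=
  (∀ n, 0 < n → IsFilterIn (G.rFam ℬ (prefixN α n)) (F n)) ∧
  (F 0 = ∅ ∨ IsFilterIn (G.rFam ℬ (prefixN α 0)) (F 0))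

/-- An admissible family for the infinite word `α`. -/
def Admissible (ℬ : Set (Set V)) (α : ℕ → L) (F : ℕ → Set (Set V)) : Prop :=
  G.IsFam ℬ α F ∧
  ∀ n, F n ⊆ {A ∈ G.rFam ℬ (prefixN α n) | G.relRange A [α n] ∈ F (n + 1)}

/-- A complete family for the infinite word `α`. -/
def Complete (ℬ : Set (Set V)) (α : ℕ → L) (F : ℕ → Set (Set V)) : Prop :=
  G.IsFam ℬ α F ∧
  ∀ n, F n = {A ∈ G.rFam ℬ (prefixN α n) | G.relRange A [α n] ∈ F (n + 1)}

/-- The subset `⋃_{n} ⋃_{A ∈ F n} ↑(α_{1,n}, A, α_{1,n})` of `E(S)` determined by an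
infinite word `α` and a family `{F n}`. -/
def filtOfFam (ℬ : Set (Set V)) (α : ℕ → L) (F : ℕ → Set (Set V)) :
    Set (List L × Set V) :=
  {q | G.ValidE ℬ q ∧ ∃ n, ∃ A ∈ F n, G.esLe (prefixN α n, A) q}

/-- The prefix `α_{1,n}` of a finite-or-infinite word. -/
def wTake : List L ⊕ (ℕ → L) → ℕ → List L
  | Sum.inl w, n => w.take n
  | Sum.inr α, n => prefixN α n

/-- `n ≤ |α|` for a finite-or-infinite word `α`. -/
def wLe (n : ℕ) : List L ⊕ (ℕ → L) → Prop
  | Sum.inl w => n ≤ w.length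
  | Sum.inr _ => True

/-- The finite-or-infinite word is a labelled path (`𝓛*(E) ∪ 𝓛^∞(E)`). -/
def wGood : List L ⊕ (ℕ → L) → Prop
  | Sum.inl w => G.IsWord w
  | Sum.inr α => G.IsInfWord α

/-- `α` is a beginning of (or equal to) `β`, for finite-or-infinite words. -/
def wBeg : List L ⊕ (ℕ → L) → List L ⊕ (ℕ → L) → Prop
  | Sum.inl a, Sum.inl b => a <+: b
  | Sum.inl a, Sum.inr β => a = prefixN β a.length
  | Sum.inr α, Sum.inr β => α = β
  | Sum.inr _, Sum.inl _ => False

/-- The word associated with a filter `ξ` in `E(S)`: for a finite word `w`, `w`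
appears in `ξ` and has the largest length; for an infinite word `α`, the words of
elements of `ξ` are beginnings of `α`, of unbounded length. -/
def HasWord (ξ : Set (List L × Set V)) : List L ⊕ (ℕ → L) → Prop
  | Sum.inl w => (∃ A, (w, A) ∈ ξ) ∧ ∀ p ∈ ξ, p.1.length ≤ w.length
  | Sum.inr α => (∀ p ∈ ξ, ∃ n, p.1 = prefixN α n) ∧ ∀ n, ∃ p ∈ ξ, n ≤ p.1.length

end LabelledGraph
namespace LabelledGraph

section Helpers

variable {V : Type u} {Ed : Type v} {L : Type w} (G : LabelledGraph V Ed L)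

lemma relRange_cons (A : Set V) (a : L) (w : List L) :
    G.relRange A (a :: w) = G.relRange (G.relRange A [a]) w := by
  cases w with
  | nil => rfl
  | cons b w =>
    ext v
    constructor
    · rintro ⟨p, hp, hpath, hmap, hs, hr⟩
      match p, hp, hpath, hmap, hs, hr with
      | [], hp, _, _, _, _ => exact absurd rfl hp
      | [e], _, _, hmap, _, _ => simp at hmap
      | e :: f :: p, _, hpath, hmap, hs, hr =>
        simp only [List.map_cons, List.cons.injEq] at hmap
        have h2 : G.rng e = G.src f ∧ G.IsPath (f :: p) := by
          unfold IsPath at hpath ⊢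
          exact List.isChain_cons_cons.mp hpath
        refine ⟨f :: p, by simp, h2.2, by simp [hmap.2], ?_, by simpa using hr⟩
        refine ⟨[e], by simp, ?_, by simp [hmap.1], by simpa using hs, by simpa using h2.1⟩
        unfold IsPath
        exact List.isChain_singleton _
    · rintro ⟨p, hp, hpath, hmap, ⟨q, hq, hqp, hqm, hqs, hqr⟩, hr⟩
      match q, hq, hqp, hqm, hqs, hqr with
      | [], hq, _, _, _, _ => exact absurd rfl hq
      | e :: f :: q, _, _, hqm, _, _ => simp at hqm
      | [e], _, _, hqm, hqs, hqr =>
        match p, hp, hpath, hmap, hr, hqr with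
        | [], hp, _, _, _, _ => exact absurd rfl hp
        | f :: p, _, hpath, hmap, hr, hqr =>
          refine ⟨e :: f :: p, by simp, ?_, ?_, by simpa using hqs, by simpa using hr⟩
          · unfold IsPath at hpath ⊢
            exact List.isChain_cons_cons.mpr ⟨by simpa using hqr, hpath⟩
          · simp at hqm hmap
            simp [hqm, hmap]

lemma relRange_append (A : Set V) (β γ : List L) :
    G.relRange A (β ++ γ) = G.relRange (G.relRange A β) γ := by
  induction β generalizing A with
  | nil => rfl
  | cons a w ih => rw [List.cons_append, relRange_cons, ih, G.relRange_cons A a w]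

lemma relRange_mono {A B : Set V} (h : A ⊆ B) (γ : List L) :
    G.relRange A γ ⊆ G.relRange B γ := by
  cases γ with
  | nil => exact h
  | cons a w =>
    rintro v ⟨p, hp, h1, h2, h3, h4⟩
    exact ⟨p, hp, h1, h2, h h3, h4⟩

lemma relRange_empty (γ : List L) : G.relRange (∅ : Set V) γ = ∅ := by
  cases γ with
  | nil => rfl
  | cons a w =>
    ext v
    constructor
    · rintro ⟨p, hp, h1, h2, h3, h4⟩
      exact h3
    · intro h
      exact h.elim

lemma isWord_right {a b : List L} (h : G.IsWord (a ++ b)) : G.IsWord b := by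
  obtain ⟨p, hp, hm⟩ := h
  obtain ⟨p1, p2, rfl, h1, h2⟩ := List.map_eq_append_iff.mp hm
  refine ⟨p2, ?_, h2⟩
  unfold IsPath at hp ⊢
  exact (List.isChain_append.mp hp).2.1

lemma isWord_left {a b : List L} (h : G.IsWord (a ++ b)) : G.IsWord a := by
  obtain ⟨p, hp, hm⟩ := h
  obtain ⟨p1, p2, rfl, h1, h2⟩ := List.map_eq_append_iff.mp hm
  refine ⟨p1, ?_, h1⟩
  unfold IsPath at hp ⊢
  exact (List.isChain_append.mp hp).1

lemma prefixN_length (α : ℕ → L) (n : ℕ) : (prefixN α n).length = n := by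
  simp [prefixN, seg]

lemma prefixN_succ (α : ℕ → L) (n : ℕ) : prefixN α (n + 1) = prefixN α n ++ [α n] := by
  simp [prefixN, seg, List.range_succ]

lemma prefixN_inj {α : ℕ → L} {n m : ℕ} (h : prefixN α n = prefixN α m) : n = m := by
  have := congrArg List.length h
  simpa [prefixN_length] using this

lemma prefixN_add (α : ℕ → L) (n k : ℕ) : ∃ γ, prefixN α (n + k) = prefixN α n ++ γ := by
  induction k with
  | zero => exact ⟨[], by simp⟩
  | succ k ih =>
    obtain ⟨γ, hγ⟩ := ih
    exact ⟨γ ++ [α (n + k)], by rw [← add_assoc, prefixN_succ, hγ, List.append_assoc]⟩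

lemma prefixN_le (α : ℕ → L) {n m : ℕ} (h : n ≤ m) :
    ∃ γ, prefixN α m = prefixN α n ++ γ := by
  obtain ⟨k, rfl⟩ := Nat.exists_eq_add_of_le h
  exact prefixN_add α n k

lemma eq_prefixN {α : ℕ → L} {n : ℕ} {w γ : List L} (h : prefixN α n = w ++ γ) :
    w = prefixN α w.length ∧ w.length ≤ n := by
  have hl := congrArg List.length h
  simp only [prefixN_length, List.length_append] at hl
  have hle : w.length ≤ n := by omega
  obtain ⟨δ, hδ⟩ := prefixN_le α hle
  rw [h] at hδ
  exact ⟨(List.append_inj hδ (by simp [prefixN_length])).1, hle⟩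

lemma isWord_prefixN {α : ℕ → L} (hα : G.IsInfWord α) (n : ℕ) : G.IsWord (prefixN α n) := by
  obtain ⟨p, hp, hl⟩ := hα
  refine ⟨(List.range n).map p, ?_, ?_⟩
  · unfold IsPath
    show List.IsChain _ _
    rw [List.isChain_map]
    rw [List.isChain_iff_getElem]
    intro i hi
    simpa using hp i
  · simp [prefixN, seg, Function.comp_def, hl]

lemma relRange_mem_rFam {ℬ : Set (Set V)} (hacc : G.Accommodating ℬ) {A : Set V}
    {w γ : List L} (hA : A ∈ G.rFam ℬ w) (hγ : G.IsWord γ) :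
    G.relRange A γ ∈ G.rFam ℬ (w ++ γ) := by
  refine ⟨hacc.1 A hA.1 γ hγ, ?_⟩
  unfold range
  rw [relRange_append]
  exact G.relRange_mono hA.2 γ

lemma complete_iff {ℬ : Set (Set V)} (hacc : G.Accommodating ℬ) {α : ℕ → L}
    (hα : G.IsInfWord α) {F : ℕ → Set (Set V)} (hF : G.Complete ℬ α F) (n k : ℕ)
    {B : Set V} (hB : B ∈ G.rFam ℬ (prefixN α n)) (γ : List L)
    (hγ : prefixN α (n + k) = prefixN α n ++ γ) :
    G.relRange B γ ∈ F (n + k) ↔ B ∈ F n := by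
  induction k generalizing γ with
  | zero =>
    have : γ = [] := by simpa using hγ
    subst this
    rfl
  | succ k ih =>
    obtain ⟨δ, hδ⟩ := prefixN_add α n k
    have h1 : γ = δ ++ [α (n + k)] := by
      rw [← add_assoc, prefixN_succ, hδ, List.append_assoc] at hγ
      exact (List.append_cancel_left hγ).symm
    have h2 : G.relRange B δ ∈ G.rFam ℬ (prefixN α (n + k)) := by
      rw [hδ]
      refine G.relRange_mem_rFam hacc hB (G.isWord_right (a := prefixN α n) ?_)
      rw [← hδ]
      exact G.isWord_prefixN hα _
    rw [← ih δ hδ, h1, relRange_append, hF.2 (n + k)]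
    exact ⟨fun h => ⟨h2, h⟩, fun h => h.2⟩

lemma fam_filter {ℬ : Set (Set V)} {α : ℕ → L} {F : ℕ → Set (Set V)}
    (hF : G.IsFam ℬ α F) {n : ℕ} {A : Set V} (hA : A ∈ F n) :
    IsFilterIn (G.rFam ℬ (prefixN α n)) (F n) := by
  rcases Nat.eq_zero_or_pos n with rfl | hn
  · rcases hF.2 with h | h
    · rw [h] at hA
      exact hA.elim
    · exact h
  · exact hF.1 n hn

lemma filter_of_complete {ℬ : Set (Set V)} (hacc : G.Accommodating ℬ) {α : ℕ → L}
    (hα : G.IsInfWord α) {F : ℕ → Set (Set V)} (hF : G.Complete ℬ α F) :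
    G.IsFilterES ℬ {p | ∃ n, p.1 = prefixN α n ∧ p.2 ∈ F n} := by
  refine ⟨?_, ?_, ?_, ?_⟩
  · obtain ⟨A, hA⟩ := (hF.1.1 1 one_pos).1
    exact ⟨(prefixN α 1, A), 1, rfl, hA⟩
  · rintro ⟨w, A⟩ ⟨n, rfl, hA⟩
    have hf := G.fam_filter hF.1 hA
    refine ⟨G.isWord_prefixN hα n, hf.2.1 hA, ?_⟩
    rintro rfl
    exact hf.2.2.1 hA
  · rintro ⟨w, A⟩ ⟨n, rfl, hA⟩ ⟨w, B⟩ ⟨hw, hB, hBne⟩ ⟨γ, h1, h2⟩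
    dsimp only at *
    obtain ⟨h3, h4⟩ := eq_prefixN h1
    obtain ⟨k, hk⟩ := Nat.exists_eq_add_of_le h4
    have hf := G.fam_filter hF.1 hA
    have hm : G.relRange B γ ∈ F n := by
      refine hf.2.2.2.1 A hA _ ?_ h2
      rw [h1]
      refine G.relRange_mem_rFam hacc hB (G.isWord_right (a := w) ?_)
      rw [← h1]
      exact G.isWord_prefixN hα _
    refine ⟨w.length, h3, ?_⟩
    refine (G.complete_iff hacc hα hF w.length k (by rwa [← h3]) γ ?_).mp ?_
    · rw [← hk, ← h3]
      exact h1
    · rwa [← hk]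
  · have key : ∀ n k A B, A ∈ F n → B ∈ F (n + k) →
        ∃ C ∈ F (n + k), G.esLe (prefixN α (n + k), C) (prefixN α n, A) ∧
          G.esLe (prefixN α (n + k), C) (prefixN α (n + k), B) := by
      intro n k A B hA hB
      obtain ⟨γ, hγ⟩ := prefixN_add α n k
      have hm := (G.complete_iff hacc hα hF n k
        ((G.fam_filter hF.1 hA).2.1 hA) γ hγ).mpr hA
      obtain ⟨C, hC, h1, h2⟩ := (G.fam_filter hF.1 hB).2.2.2.2 _ hm _ hB
      exact ⟨C, hC, ⟨γ, hγ, h1⟩, ⟨[], by simp, h2⟩⟩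
    rintro ⟨w, A⟩ ⟨n, rfl, hA⟩ ⟨w, B⟩ ⟨m, rfl, hB⟩
    rcases le_total n m with h | h
    · obtain ⟨k, rfl⟩ := Nat.exists_eq_add_of_le h
      obtain ⟨C, hC, h1, h2⟩ := key n k A B hA hB
      exact ⟨(prefixN α (n + k), C), ⟨_, rfl, hC⟩, h1, h2⟩
    · obtain ⟨k, rfl⟩ := Nat.exists_eq_add_of_le h
      obtain ⟨C, hC, h1, h2⟩ := key m k B A hB hA
      exact ⟨(prefixN α (m + k), C), ⟨_, rfl, hC⟩, h2, h1⟩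

lemma complete_of_filter {ℬ : Set (Set V)} (hacc : G.Accommodating ℬ)
    (hwlr : G.WeaklyLeftResolving ℬ) {α : ℕ → L}
    (hα : G.IsInfWord α) {η : Set (List L × Set V)} (hη : G.IsFilterES ℬ η)
    (hw : HasWord η (Sum.inr α)) :
    G.Complete ℬ α (fun n => {A | (prefixN α n, A) ∈ η}) := by
  obtain ⟨-, hval, hup, hdir⟩ := hη
  obtain ⟨hw1, hw2⟩ := hw
  have hrest : ∀ n A, (prefixN α n, A) ∈ η →
      (n = 0 ∨ True) → IsFilterIn (G.rFam ℬ (prefixN α n)) {A | (prefixN α n, A) ∈ η} := by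
    intro n A hA _
    refine ⟨⟨A, hA⟩, fun B hB => (hval _ hB).2.1, fun h => (hval _ h).2.2 rfl, ?_, ?_⟩
    · intro B hB C hC hBC
      refine hup _ hB _ ⟨G.isWord_prefixN hα n, hC, ?_⟩ ⟨[], by simp, hBC⟩
      rintro rfl
      exact (hval _ hB).2.2 (Set.subset_empty_iff.mp hBC)
    · intro B hB C hC
      obtain ⟨⟨w, D⟩, hz, ⟨γ, h1, h2⟩, ⟨δ, h3, h4⟩⟩ := hdir _ hB _ hC
      dsimp only at *
      have hγδ : δ = γ := by
        rw [h1] at h3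
        exact (List.append_cancel_left h3).symm
      subst hγδ
      have hBv := hval _ hB
      have hCv := hval _ hC
      have hD : D ⊆ G.relRange (B ∩ C) δ := by
        by_cases hd : δ = []
        · subst hd
          exact Set.subset_inter h2 h4
        · rw [hwlr B hBv.2.1.1 C hCv.2.1.1 δ hd]
          exact Set.subset_inter h2 h4
      refine ⟨B ∩ C, ?_, Set.inter_subset_left, Set.inter_subset_right⟩
      refine hup _ hz _ ⟨G.isWord_prefixN hα n, ⟨hacc.2.1 B hBv.2.1.1 C hCv.2.1.1,
        Set.inter_subset_left.trans hBv.2.1.2⟩, ?_⟩ ⟨δ, h1, hD⟩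
      intro he
      dsimp only at he
      rw [he, relRange_empty] at hD
      exact (hval _ hz).2.2 (Set.subset_empty_iff.mp hD)
  refine ⟨⟨?_, ?_⟩, ?_⟩
  · intro n hn
    obtain ⟨⟨w, A⟩, hp, hlen⟩ := hw2 n
    obtain ⟨m, hm⟩ := hw1 _ hp
    dsimp only at hm hlen
    subst hm
    rw [prefixN_length] at hlen
    obtain ⟨γ, hγ⟩ := prefixN_le α hlen
    have hsub : A ⊆ G.relRange (G.range (prefixN α n)) γ := by
      have := (hval _ hp).2.1.2
      dsimp only at this
      rw [hγ] at this
      unfold range at this ⊢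
      rwa [relRange_append] at this
    have hne : prefixN α n ≠ [] := by
      intro h
      have := congrArg List.length h
      rw [prefixN_length] at this
      simp at this
      omega
    refine hrest n (G.range (prefixN α n)) ?_ (Or.inr trivial)
    refine hup _ hp _ ⟨G.isWord_prefixN hα n,
      ⟨hacc.2.2.2 _ hne (G.isWord_prefixN hα n), subset_rfl⟩, ?_⟩ ⟨γ, hγ, hsub⟩
    intro he
    dsimp only at he
    rw [he, relRange_empty] at hsub
    exact (hval _ hp).2.2 (Set.subset_empty_iff.mp hsub)
  · rcases Set.eq_empty_or_nonempty {A | (prefixN α 0, A) ∈ η} with h | ⟨A, hA⟩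
    · exact Or.inl h
    · exact Or.inr (hrest 0 A hA (Or.inr trivial))
  · intro n
    have hwn : G.IsWord [α n] := by
      refine G.isWord_right (a := prefixN α n) ?_
      rw [← prefixN_succ]
      exact G.isWord_prefixN hα _
    ext A
    constructor
    · intro hA
      have hA' : (prefixN α n, A) ∈ η := hA
      refine ⟨(hval _ hA').2.1, ?_⟩
      obtain ⟨⟨w, B⟩, hp, hlen⟩ := hw2 (n + 1)
      obtain ⟨⟨z, C⟩, hz, ⟨γ, h1, h2⟩, ⟨δ, h3, h4⟩⟩ := hdir _ hA' _ hp
      obtain ⟨m, hm⟩ := hw1 _ hz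
      dsimp only at *
      subst hm
      have hnm : n + 1 ≤ m := by
        have := congrArg List.length h3
        simp only [prefixN_length, List.length_append] at this
        omega
      obtain ⟨ε, hε⟩ := prefixN_le α hnm
      have hγ : γ = [α n] ++ ε := by
        rw [hε, prefixN_succ, List.append_assoc] at h1
        exact (List.append_cancel_left h1).symm
      rw [hγ, relRange_append] at h2
      show (prefixN α (n + 1), G.relRange A [α n]) ∈ η
      refine hup _ hz _ ⟨G.isWord_prefixN hα _, ?_, ?_⟩ ⟨ε, hε, h2⟩
      · show _ ∈ G.rFam ℬ (prefixN α (n + 1))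
        rw [prefixN_succ]
        exact G.relRange_mem_rFam hacc (hval _ hA').2.1 hwn
      · intro he
        dsimp only at he
        rw [he, relRange_empty] at h2
        exact (hval _ hz).2.2 (Set.subset_empty_iff.mp h2)
    · rintro ⟨hA, hA2⟩
      have hA2' : (prefixN α (n + 1), G.relRange A [α n]) ∈ η := hA2
      refine hup _ hA2' _ ⟨G.isWord_prefixN hα n, hA, ?_⟩ ⟨[α n], prefixN_succ α n, subset_rfl⟩
      intro he
      dsimp only at he
      apply (hval _ hA2').2.2
      dsimp only
      rw [he, relRange_empty]

lemma hasWord_of_superset {ℬ : Set (Set V)} {α : ℕ → L} {ξ η : Set (List L × Set V)}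
    (hη : G.IsFilterES ℬ η) (hw : HasWord ξ (Sum.inr α)) (hsub : ξ ⊆ η) :
    HasWord η (Sum.inr α) := by
  obtain ⟨-, hval, hup, hdir⟩ := hη
  obtain ⟨hw1, hw2⟩ := hw
  refine ⟨?_, fun n => ?_⟩
  · intro p hp
    obtain ⟨q, hq, hlen⟩ := hw2 p.1.length
    obtain ⟨z, hz, ⟨γ, h1, -⟩, ⟨δ, h3, -⟩⟩ := hdir _ hp _ (hsub hq)
    obtain ⟨n, hn⟩ := hw1 q hq
    have hpre : p.1 <+: q.1 :=
      List.prefix_of_prefix_length_le ⟨γ, h1.symm⟩ ⟨δ, h3.symm⟩ hlen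
    obtain ⟨ε, hε⟩ := hpre
    rw [hn] at hε
    exact ⟨_, (eq_prefixN hε.symm).1⟩
  · obtain ⟨q, hq, hlen⟩ := hw2 n
    exact ⟨q, hsub hq, hlen⟩

end Helpers

/-- A filter `ξ = ξ^α` in `E(S)` of infinite type (with word
`α ∈ 𝓛^∞(E)` and associated complete family `{ξ_n}`) is an ultrafilter iff `{ξ_n}`
is maximal among all complete families for `α`. -/
theorem ultrafilter_infinite_type_iff_maximal {V : Type u} {Ed : Type v} {L : Type w}
    [Nonempty V] [Countable V] [Nonempty Ed] [Countable Ed]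
    (G : LabelledGraph V Ed L) (ℬ : Set (Set V))
    (hacc : G.Accommodating ℬ) (hwlr : G.WeaklyLeftResolving ℬ)
    (ξ : Set (List L × Set V)) (hξ : G.IsFilterES ℬ ξ)
    (α : ℕ → L) (hα : G.IsInfWord α) (hw : HasWord ξ (Sum.inr α)) :
    G.IsUltraES ℬ ξ ↔
      ∀ F : ℕ → Set (Set V), G.Complete ℬ α F →
        (∀ n, {A : Set V | (prefixN α n, A) ∈ ξ} ⊆ F n) →
        ∀ n, F n = {A : Set V | (prefixN α n, A) ∈ ξ} := by
  constructor
  · intro hU F hF hsub n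
    have hη := G.filter_of_complete hacc hα hF
    have heq := hU.2 _ hη (by
      intro p hp
      obtain ⟨m, hm⟩ := hw.1 p hp
      refine ⟨m, hm, hsub m ?_⟩
      show (prefixN α m, p.2) ∈ ξ
      rw [← hm]
      exact hp)
    refine Set.Subset.antisymm (fun A hA => ?_) (hsub n)
    show (prefixN α n, A) ∈ ξ
    rw [heq]
    exact ⟨n, rfl, hA⟩
  · intro hmax
    refine ⟨hξ, fun η hη hsub => Set.Subset.antisymm hsub ?_⟩
    have hwη := G.hasWord_of_superset hη hw hsub
    have hall := hmax _ (G.complete_of_filter hacc hwlr hα hη hwη) (fun n A hA => hsub hA)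
    rintro ⟨w, A⟩ hp
    obtain ⟨n, hn⟩ := hwη.1 _ hp
    dsimp only at hn
    subst hn
    have : A ∈ {A : Set V | (prefixN α n, A) ∈ η} := hp
    rw [hall n] at this
    exact this

end LabelledGraph
end

section
/- Let (E, 𝓛, ℬ) be a weakly left resolving labelled space such that ℬ is closed under relative complements, with associated inverse semigroup S, and let ξ^α be a filter in E(S) with associated family {ξ_n}_{0≤n≤|α|}. If ξ_n is an ultrafilter in ℬ_{α_{1,n}} for some n with 0 < n ≤ |α|, then ξ_m is an ultrafilter in ℬ_{α_{1,m}} for every 0 < m < n; if moreover ξ_0 is nonempty, then ξ_0 is an ultrafilter in ℬ. -/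
universe u v w

attribute [local instance] Classical.propDecidable

namespace LabelledGraph

theorem aux_relRange_ne {V : Type u} {Ed : Type v} {L : Type w}
    (G : LabelledGraph V Ed L) (A : Set V) (α : List L) (hα : α ≠ []) (v : V) :
    v ∈ G.relRange A α ↔ ∃ (p : List Ed) (h : p ≠ []), G.IsPath p ∧ p.map G.lbl = α ∧
        G.src (p.head h) ∈ A ∧ G.rng (p.getLast h) = v := by
  cases α with
  | nil => exact absurd rfl hα
  | cons a w => rfl

theorem aux_relRange_mono {V : Type u} {Ed : Type v} {L : Type w}
    (G : LabelledGraph V Ed L) {A B : Set V} (hAB : A ⊆ B) (α : List L) :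
    G.relRange A α ⊆ G.relRange B α := by
  cases α with
  | nil => exact hAB
  | cons a w =>
    rintro v ⟨p, h, h1, h2, h3, h4⟩
    exact ⟨p, h, h1, h2, hAB h3, h4⟩

theorem aux_relRange_union {V : Type u} {Ed : Type v} {L : Type w}
    (G : LabelledGraph V Ed L) (A B : Set V) (α : List L) :
    G.relRange (A ∪ B) α = G.relRange A α ∪ G.relRange B α := by
  apply Set.Subset.antisymm
  · cases α with
    | nil => exact subset_rfl
    | cons a w =>
      rintro v ⟨p, h, h1, h2, h3 | h3, h4⟩
      · exact Or.inl ⟨p, h, h1, h2, h3, h4⟩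
      · exact Or.inr ⟨p, h, h1, h2, h3, h4⟩
  · exact Set.union_subset (aux_relRange_mono G Set.subset_union_left α)
      (aux_relRange_mono G Set.subset_union_right α)

theorem aux_relRange_empty {V : Type u} {Ed : Type v} {L : Type w}
    (G : LabelledGraph V Ed L) (α : List L) : G.relRange ∅ α = ∅ := by
  cases α with
  | nil => rfl
  | cons a w =>
    rw [Set.eq_empty_iff_forall_notMem]
    rintro v ⟨p, h, h1, h2, h3, h4⟩
    exact h3

theorem aux_relRange_append {V : Type u} {Ed : Type v} {L : Type w}
    (G : LabelledGraph V Ed L) (A : Set V) (α β : List L) :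
    G.relRange A (α ++ β) = G.relRange (G.relRange A α) β := by
  by_cases hα : α = []
  · subst hα; rfl
  by_cases hβ : β = []
  · subst hβ; simp [relRange]
  ext v
  rw [aux_relRange_ne G _ _ (by simp [hα]), aux_relRange_ne G _ _ hβ]
  constructor
  · rintro ⟨p, h, h1, h2, h3, h4⟩
    obtain ⟨p1, p2, rfl, e1, e2⟩ := List.map_eq_append_iff.1 h2
    have n1 : p1 ≠ [] := by rintro rfl; exact hα e1.symm
    have n2 : p2 ≠ [] := by rintro rfl; exact hβ e2.symm
    obtain ⟨c1, c2, c3⟩ := List.isChain_append.1 h1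
    refine ⟨p2, n2, c2, e2, ?_, ?_⟩
    · rw [aux_relRange_ne G _ _ hα]
      refine ⟨p1, n1, c1, e1, ?_, ?_⟩
      · rwa [List.head_append_of_ne_nil n1] at h3
      · exact c3 _ (List.getLast_mem_getLast? n1) _ (List.head_mem_head? n2)
    · rwa [List.getLast_append_of_ne_nil _ n2] at h4
  · rintro ⟨p2, n2, c2, e2, h3, h4⟩
    rw [aux_relRange_ne G _ _ hα] at h3
    obtain ⟨p1, n1, c1, e1, h5, h6⟩ := h3
    refine ⟨p1 ++ p2, by simp [n1], ?_, by simp [e1, e2], ?_, ?_⟩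
    · refine List.isChain_append.2 ⟨c1, c2, ?_⟩
      intro x hx y hy
      rw [List.getLast?_eq_getLast_of_ne_nil n1] at hx
      rw [List.head?_eq_some_head n2] at hy
      cases hx; cases hy
      exact h6
    · rwa [List.head_append_of_ne_nil n1]
    · rwa [List.getLast_append_of_ne_nil _ n2]

theorem aux_isWord_append {V : Type u} {Ed : Type v} {L : Type w}
    (G : LabelledGraph V Ed L) {α β : List L} (h : G.IsWord (α ++ β)) :
    G.IsWord α ∧ G.IsWord β := by
  obtain ⟨p, h1, h2⟩ := h
  obtain ⟨p1, p2, rfl, e1, e2⟩ := List.map_eq_append_iff.1 h2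
  obtain ⟨c1, c2, c3⟩ := List.isChain_append.1 h1
  exact ⟨⟨p1, c1, e1⟩, ⟨p2, c2, e2⟩⟩

theorem aux_prime {V : Type u} {C F : Set (Set V)}
    (hC : ∀ A ∈ C, ∀ B ∈ C, A ∩ B ∈ C) (hF : IsUltraIn C F)
    {X Y : Set V} (hX : X ∈ C) (hY : Y ∈ C) (hXY : X ∪ Y ∈ F) : X ∈ F ∨ Y ∈ F := by
  obtain ⟨⟨hne, hsub, hemp, hup, hdir⟩, hmax⟩ := hF
  by_cases hA : ∃ A ∈ F, A ∩ X = ∅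
  · right
    obtain ⟨A, hA, hAX⟩ := hA
    obtain ⟨D, hD, h1, h2⟩ := hdir A hA _ hXY
    refine hup D hD Y hY ?_
    intro v hv
    rcases h2 hv with h | h
    · exact absurd (show v ∈ A ∩ X from ⟨h1 hv, h⟩) (by simp [hAX])
    · exact h
  · left
    push Not at hA
    have key := hmax {D | D ∈ C ∧ ∃ A ∈ F, A ∩ X ⊆ D} ?_ ?_
    · rw [key]
      obtain ⟨A, hA'⟩ := hne
      exact ⟨hX, A, hA', Set.inter_subset_right⟩
    · refine ⟨⟨X, hX, _, hXY, Set.inter_subset_right⟩, fun D h => h.1, ?_, ?_, ?_⟩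
      · rintro ⟨-, A, h1, h2⟩
        exact (hA A h1).ne_empty (Set.subset_empty_iff.1 h2)
      · rintro D ⟨-, A, h1, h2⟩ B hB hDB
        exact ⟨hB, A, h1, h2.trans hDB⟩
      · rintro D ⟨-, A, h1, h2⟩ D' ⟨-, A', h1', h2'⟩
        obtain ⟨Z, hZ, z1, z2⟩ := hdir A h1 A' h1'
        exact ⟨Z ∩ X, ⟨hC _ (hsub hZ) _ hX, Z, hZ, subset_rfl⟩,
          (Set.inter_subset_inter_left X z1).trans h2,
          (Set.inter_subset_inter_left X z2).trans h2'⟩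
    · intro D hD
      exact ⟨hsub hD, D, hD, Set.inter_subset_left⟩

theorem aux_main {V : Type u} {Ed : Type v} {L : Type w}
    (G : LabelledGraph V Ed L) (ℬ : Set (Set V))
    (hacc : G.Accommodating ℬ) (hwlr : G.WeaklyLeftResolving ℬ)
    (hrc : ClosedUnderRelComp ℬ)
    (ξ : Set (List L × Set V)) (hξ : G.IsFilterES ℬ ξ) (α γ : List L)
    (hun : IsUltraIn (G.rFam ℬ (α ++ γ)) {A : Set V | (α ++ γ, A) ∈ ξ})
    (hne : {A : Set V | (α, A) ∈ ξ}.Nonempty) :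
    IsUltraIn (G.rFam ℬ α) {A : Set V | (α, A) ∈ ξ} := by
  obtain ⟨-, hval, hup, hdir⟩ := hξ
  obtain ⟨hB1, hB2, hB3, hB4⟩ := hacc
  obtain ⟨D, hD⟩ := hun.1.1
  have hwd : G.IsWord (α ++ γ) := (hval _ hD).1
  obtain ⟨hwα, hwγ⟩ := aux_isWord_append G hwd
  have hC : ∀ δ, ∀ A ∈ G.rFam ℬ δ, ∀ B ∈ G.rFam ℬ δ, A ∩ B ∈ G.rFam ℬ δ :=
    fun δ A hA B hB => ⟨hB2 _ hA.1 _ hB.1, Set.inter_subset_left.trans hA.2⟩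
  have hrr : ∀ A ∈ G.rFam ℬ α, G.relRange A γ ∈ G.rFam ℬ (α ++ γ) := by
    intro A hA
    refine ⟨hB1 _ hA.1 _ hwγ, ?_⟩
    unfold range
    rw [aux_relRange_append]
    exact aux_relRange_mono G hA.2 γ
  have hdirα : ∀ A, (α, A) ∈ ξ → ∀ B, (α, B) ∈ ξ → (α, A ∩ B) ∈ ξ := by
    intro A hA B hB
    obtain ⟨⟨z, Z⟩, hz, ⟨δ, h1, h2⟩, ⟨δ', h1', h2'⟩⟩ := hdir _ hA _ hB
    dsimp only at h1 h2 h1' h2'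
    subst h1
    obtain rfl : δ = δ' := List.append_cancel_left h1'
    have hsub : Z ⊆ G.relRange (A ∩ B) δ := by
      by_cases hδ : δ = []
      · subst hδ; exact Set.subset_inter h2 h2'
      · rw [hwlr _ (hval _ hA).2.1.1 _ (hval _ hB).2.1.1 _ hδ]
        exact Set.subset_inter h2 h2'
    refine hup _ hz _ ⟨hwα, hC _ _ (hval _ hA).2.1 _ (hval _ hB).2.1, ?_⟩ ⟨δ, rfl, hsub⟩
    intro he
    dsimp only at he
    rw [he, aux_relRange_empty] at hsub
    exact (hval _ hz).2.2 (Set.subset_empty_iff.1 hsub)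
  have hfwd : ∀ A, (α, A) ∈ ξ → (α ++ γ, G.relRange A γ) ∈ ξ := by
    intro A hA
    obtain ⟨⟨z, Z⟩, hz, ⟨δ, h1, h2⟩, ⟨δ', h1', h2'⟩⟩ := hdir _ hA _ hD
    dsimp only at h1 h2 h1' h2'
    subst h1
    rw [List.append_assoc] at h1'
    obtain rfl : δ = γ ++ δ' := List.append_cancel_left h1'
    rw [aux_relRange_append] at h2
    refine hup _ hz _ ⟨hwd, hrr _ (hval _ hA).2.1, ?_⟩ ⟨δ', by simp, h2⟩
    intro he
    dsimp only at he
    rw [he, aux_relRange_empty] at h2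
    exact (hval _ hz).2.2 (Set.subset_empty_iff.1 h2)
  have hback : ∀ A ∈ G.rFam ℬ α, (α ++ γ, G.relRange A γ) ∈ ξ → (α, A) ∈ ξ := by
    intro A hA h
    refine hup _ h _ ⟨hwα, hA, ?_⟩ ⟨γ, rfl, subset_rfl⟩
    intro he
    dsimp only at he
    refine (hval _ h).2.2 ?_
    rw [he]; exact aux_relRange_empty G γ
  refine ⟨⟨hne, fun A hA => (hval _ hA).2.1, fun h => (hval _ h).2.2 rfl, ?_, ?_⟩, ?_⟩
  · intro A hA B hB hAB
    refine hup _ hA _ ⟨hwα, hB, ?_⟩ ⟨[], by simp, hAB⟩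
    rintro rfl
    exact (hval _ hA).2.2 (Set.subset_empty_iff.1 hAB)
  · intro A hA B hB
    exact ⟨A ∩ B, hdirα A hA B hB, Set.inter_subset_left, Set.inter_subset_right⟩
  · intro F' hF' hsub
    refine Set.Subset.antisymm hsub ?_
    intro B hB
    obtain ⟨-, f1, f2, f3, f4⟩ := hF'
    obtain ⟨K, hK⟩ := hne
    have hKv := (hval _ hK).2.1
    have hBv := f1 hB
    have hi : K ∩ B ∈ G.rFam ℬ α := hC _ _ hKv _ hBv
    have hd : K \ B ∈ G.rFam ℬ α := ⟨hrc _ hKv.1 _ hBv.1, Set.diff_subset.trans hKv.2⟩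
    have hu : G.relRange (K ∩ B) γ ∪ G.relRange (K \ B) γ ∈
        {A : Set V | (α ++ γ, A) ∈ ξ} := by
      rw [← aux_relRange_union, Set.inter_union_diff]
      exact hfwd K hK
    rcases aux_prime (hC _) hun (hrr _ hi) (hrr _ hd) hu with h | h
    · have h' := hback _ hi h
      refine hup _ h' _ ⟨hwα, hBv, ?_⟩ ⟨[], by simp, Set.inter_subset_right⟩
      rintro rfl
      exact f2 hB
    · have h' := hsub (hback _ hd h)
      obtain ⟨Z, hZ, z1, z2⟩ := f4 _ h' _ hB
      exfalso
      have : Z = ∅ := by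
        rw [Set.eq_empty_iff_forall_notMem]
        intro v hv
        exact (z1 hv).2 (z2 hv)
      exact f2 (this ▸ hZ)

theorem aux_wTake {L : Type w} (w : List L ⊕ (ℕ → L)) (n m : ℕ) (h : m ≤ n) :
    ∃ γ, wTake w n = wTake w m ++ γ := by
  cases w with
  | inl w => exact ⟨_, (List.prefix_iff_eq_append.1 (List.take_prefix_take_left (l := w) h)).symm⟩
  | inr a =>
    obtain ⟨k, rfl⟩ := Nat.exists_eq_add_of_le h
    exact ⟨_, by simp only [wTake, prefixN, seg, Nat.sub_zero, List.range_add, List.map_append]; rfl⟩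

theorem aux_wTake_ne {L : Type w} (w : List L ⊕ (ℕ → L)) (n m : ℕ) (h : m ≤ n)
    (hn : wLe n w) (hm : 0 < m) : wTake w m ≠ [] := by
  intro he
  have := congrArg List.length he
  cases w with
  | inl w => simp only [wTake, wLe, List.length_take, List.length_nil] at this hn; omega
  | inr a => simp [wTake, prefixN, seg] at this; omega

/-- Suppose `ℬ` is moreover closed under relative complements, and
let `ξ = ξ^α` be a filter in `E(S)` with associated family `{ξ_n}`. If `ξ_n` is an
ultrafilter in `ℬ_{α_{1,n}}` for some `0 < n ≤ |α|`, then `ξ_m` is an ultrafilter in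
`ℬ_{α_{1,m}}` for every `0 < m < n`; if moreover `ξ_0` is nonempty, then `ξ_0` is an
ultrafilter in `ℬ`. -/
theorem family_ultrafilters {V : Type u} {Ed : Type v} {L : Type w}
    [Nonempty V] [Countable V] [Nonempty Ed] [Countable Ed]
    (G : LabelledGraph V Ed L) (ℬ : Set (Set V))
    (hacc : G.Accommodating ℬ) (hwlr : G.WeaklyLeftResolving ℬ)
    (hrc : ClosedUnderRelComp ℬ)
    (ξ : Set (List L × Set V)) (hξ : G.IsFilterES ℬ ξ)
    (w : List L ⊕ (ℕ → L)) (hgw : G.wGood w) (hw : HasWord ξ w)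
    (n : ℕ) (hn : 0 < n) (hnle : wLe n w)
    (hun : IsUltraIn (G.rFam ℬ (wTake w n)) {A : Set V | (wTake w n, A) ∈ ξ}) :
    (∀ m, 0 < m → m < n →
      IsUltraIn (G.rFam ℬ (wTake w m)) {A : Set V | (wTake w m, A) ∈ ξ}) ∧
    ({A : Set V | (wTake w 0, A) ∈ ξ}.Nonempty →
      IsUltraIn (G.rFam ℬ (wTake w 0)) {A : Set V | (wTake w 0, A) ∈ ξ}) := by
  refine ⟨fun m hm hmn => ?_, fun hne => ?_⟩
  · obtain ⟨γ, hγ⟩ := aux_wTake w n m hmn.le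
    have hα := aux_wTake_ne w n m hmn.le hnle hm
    rw [hγ] at hun
    refine aux_main G ℬ hacc hwlr hrc ξ hξ _ γ hun ?_
    obtain ⟨D, hD⟩ := hun.1.1
    have hv := hξ.2.1 _ hD
    have hwα := (aux_isWord_append G hv.1).1
    have hs : D ⊆ G.relRange (G.range (wTake w m)) γ := by
      have := hv.2.1.2
      unfold range at this ⊢
      rwa [aux_relRange_append] at this
    refine ⟨G.range (wTake w m), hξ.2.2.1 _ hD _
      ⟨hwα, ⟨hacc.2.2.2 _ hα hwα, subset_rfl⟩, ?_⟩ ⟨γ, rfl, hs⟩⟩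
    intro he
    dsimp only at he
    rw [he, aux_relRange_empty] at hs
    exact hv.2.2 (Set.subset_empty_iff.1 hs)
  · obtain ⟨γ, hγ⟩ := aux_wTake w n 0 hn.le
    rw [hγ] at hun
    exact aux_main G ℬ hacc hwlr hrc ξ hξ _ γ hun hne

end LabelledGraph
end
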